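/- (Density of accessible prime ends and accessible points, plane case.) Let U ⊆ ℝ² be an open simply connected set such that ℝ²∖U has more than one point. Then: (a) the accessible prime ends are dense in b_E(U,ℝ²); and (b) the accessible points of ∂U are dense in ∂U. -/

import Mathlib

open Set Topology Filter

noncomputable section

universe u

variable {X : Type u} [TopologicalSpace X]

/-- A homeomorphism is *orientation preserving* if it is isotopic to the identity. -/
def IsOrientationPreserving (f : X ≃ₜ X) : Prop :=
  ∃ H : unitInterval × X → X,
    Continuous H ∧ (∀ x, H (0, x) = x) ∧ (∀ x, H (1, x) = f x) ∧
      ∀ t : unitInterval, IsHomeomorph fun x => H (t, x)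

/-- `D` is a connected component of `A`. -/
def IsCompOf (A D : Set X) : Prop := ∃ x ∈ A, D = connectedComponentIn A x

/-- `A` has exactly two connected components, the distinct sets `D₁` and `D₂`. -/
def HasTwoComps (A D₁ D₂ : Set X) : Prop :=
  IsCompOf A D₁ ∧ IsCompOf A D₂ ∧ D₁ ≠ D₂ ∧
    ∀ x ∈ A, connectedComponentIn A x = D₁ ∨ connectedComponentIn A x = D₂

/-- A *cross-cut* of the open set `U`: the image of an arc `g` on `(0,1)`, where `g` is
continuous and injective on `[0,1]`'s interior, runs inside `U`, has endpoints on `∂U`, and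
separates `U` into exactly two components, each with a boundary point on `∂U` away from the
closed arc. -/
def IsCrossCut (U γ : Set X) : Prop :=
  ∃ g : ℝ → X,
    ContinuousOn g (Icc 0 1) ∧ InjOn g (Ioo 0 1) ∧ (∀ t ∈ Ioo (0:ℝ) 1, g t ∈ U) ∧
      g 0 ∈ frontier U ∧ g 1 ∈ frontier U ∧ γ = g '' Ioo 0 1 ∧
      ∃ D₁ D₂ : Set X, HasTwoComps (U \ γ) D₁ D₂ ∧
        (frontier D₁ ∩ (frontier U \ g '' Icc 0 1)).Nonempty ∧
        (frontier D₂ ∩ (frontier U \ g '' Icc 0 1)).Nonempty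

/-- A *cross-section* of `U`: a connected component of `U ∖ γ` for a cross-cut `γ`. -/
def IsCrossSection (U D : Set X) : Prop := ∃ γ : Set X, IsCrossCut U γ ∧ IsCompOf (U \ γ) D

/-- The image of a set under the `k`-th integer iterate of a homeomorphism. -/
def iterZ (f : X ≃ₜ X) (k : ℤ) (A : Set X) : Set X := ⇑(f.toEquiv ^ k) '' A

/-- A cross-section of `U` which is wandering for `f^n`. -/
def IsWanderingSection (f : X ≃ₜ X) (U : Set X) (n : ℕ) (D : Set X) : Prop :=
  IsCrossSection U D ∧ ∀ k : ℤ, k ≠ 0 → iterZ f ((n : ℤ) * k) D ∩ D = ∅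

/-- `f` is ∂-nonwandering in `U`. -/
def BdNonwandering (f : X ≃ₜ X) (U : Set X) : Prop :=
  ∀ n : ℕ, 1 ≤ n → ∃ K : Set X, IsCompact K ∧ K ⊆ U ∧
    ∀ D : Set X, IsWanderingSection f U n D →
      (∃ k : ℤ, 0 < k ∧ (iterZ f ((n : ℤ) * k) D ∩ K).Nonempty) ∧
      (∃ k : ℤ, k < 0 ∧ (iterZ f ((n : ℤ) * k) D ∩ K).Nonempty)

/-- The boundary of `D` inside `U` (for `D` open in `U`). -/
def bdIn (U D : Set X) : Set X := (closure D \ D) ∩ U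

/-- A chain of cross-sections of `U`. -/
def IsPEChain (U : Set X) (D : ℕ → Set X) : Prop :=
  (∀ i, IsCrossSection U (D i)) ∧ (∀ i j : ℕ, j ≤ i → D i ⊆ D j) ∧
    ∀ i j : ℕ, i ≠ j → closure (bdIn U (D i)) ∩ closure (bdIn U (D j)) = ∅

/-- The chain `D` divides the cross-section `E`. -/
def ChainDividesSection (D : ℕ → Set X) (E : Set X) : Prop := ∃ N : ℕ, ∀ i, N ≤ i → D i ⊆ E

/-- The chain `D` divides the chain `D'`. -/
def ChainDivides (D D' : ℕ → Set X) : Prop := ∀ n : ℕ, ∃ m : ℕ, D m ⊆ D' n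

/-- A prime chain: a chain dividing every chain that divides it. -/
def IsPrimeChain (U : Set X) (D : ℕ → Set X) : Prop :=
  IsPEChain U D ∧ ∀ D' : ℕ → Set X, IsPEChain U D' → ChainDivides D' D → ChainDivides D D'

/-- The type of prime chains of `U`. -/
def PrimeChain (U : Set X) : Type u := {D : ℕ → Set X // IsPrimeChain U D}

/-- A prime end of `U`: an equivalence class of prime chains. -/
def PrimeEnd (U : Set X) : Type u :=
  Quot fun C C' : PrimeChain U => ChainDivides C.1 C'.1 ∧ ChainDivides C'.1 C.1

/-- The prime end `p` divides the cross-section `E`. -/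
def PrimeEndDivides {U : Set X} (p : PrimeEnd U) (E : Set X) : Prop :=
  ∃ C : PrimeChain U, Quot.mk _ C = p ∧ ChainDividesSection C.1 E

/-- The prime ends compactification of `U` (as a set: `U ⊔ (prime ends)`). -/
def PrimeEndComp (U : Set X) : Type u := ↥U ⊕ PrimeEnd U

/-- A point of `U`, as an element of the prime ends compactification. -/
def pePt (U : Set X) (x : ↥U) : PrimeEndComp U := Sum.inl x

/-- A prime end, as an element of the prime ends compactification. -/
def peEnd (U : Set X) (p : PrimeEnd U) : PrimeEndComp U := Sum.inr p

/-- The copy of a subset `V ⊆ U` inside the prime ends compactification. -/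
def peOpen (U V : Set X) : Set (PrimeEndComp U) := {z | ∃ x : ↥U, z = pePt U x ∧ (x : X) ∈ V}

/-- The basic set `E ∪ i_E(E)` of the prime ends compactification, for a cross-section `E`. -/
def peSection (U E : Set X) : Set (PrimeEndComp U) :=
  peOpen U E ∪ {z | ∃ p : PrimeEnd U, z = peEnd U p ∧ PrimeEndDivides p E}

/-- The topology of the prime ends compactification. -/
instance primeEndCompTopology (U : Set X) : TopologicalSpace (PrimeEndComp U) :=
  TopologicalSpace.generateFrom
    ({s | ∃ V : Set X, IsOpen V ∧ V ⊆ U ∧ s = peOpen U V} ∪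
      {s | ∃ E : Set X, IsCrossSection U E ∧ s = peSection U E})

/-- The circle of prime ends, as a subset of the prime ends compactification. -/
def PrimeEndCircle (U : Set X) : Set (PrimeEndComp U) := Set.range (peEnd U)

/-- `F` is an extension of `f|_U` to the prime ends compactification of `U`. -/
def IsPEExtension (f : X ≃ₜ X) (U : Set X) (F : PrimeEndComp U ≃ₜ PrimeEndComp U) : Prop :=
  ∀ (x : X) (hx : x ∈ U) (hfx : f x ∈ U), F (pePt U ⟨x, hx⟩) = pePt U ⟨f x, hfx⟩

/-- An end-cut of `U`: an injective arc in `U` defined on `[0,1)` converging in the ambient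
space as `t → 1⁻`. -/
def IsEndCut (U : Set X) (γ : ℝ → X) : Prop :=
  ContinuousOn γ (Ico 0 1) ∧ InjOn γ (Ico 0 1) ∧ (∀ t ∈ Ico (0:ℝ) 1, γ t ∈ U) ∧
    ∃ z : X, Tendsto γ (𝓝[<] (1:ℝ)) (𝓝 z)

/-- `z` is an accessible point of `∂U`. -/
def IsAccessiblePoint (U : Set X) (z : X) : Prop :=
  ∃ γ : ℝ → X, IsEndCut U γ ∧ Tendsto γ (𝓝[<] (1:ℝ)) (𝓝 z)

/-- `p` is an accessible prime end of `U`. -/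
def IsAccessiblePrimeEnd (U : Set X) (p : PrimeEnd U) : Prop :=
  ∃ (γ : ℝ → X) (hγ : ∀ t ∈ Ico (0:ℝ) 1, γ t ∈ U), IsEndCut U γ ∧
    Tendsto (fun t : ↥(Ico (0:ℝ) 1) => pePt U ⟨γ ↑t, hγ ↑t t.2⟩)
      (comap Subtype.val (𝓝[<] (1:ℝ))) (𝓝 (peEnd U p))

/-- A translation arc for `f` based at `x`: a simple arc from `x` to `f x` meeting its image
only as allowed. -/
def IsTranslationArc (f : X ≃ₜ X) (γ : Set X) (x : X) : Prop :=
  f x ≠ x ∧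
    ∃ g : ℝ → X, ContinuousOn g (Icc 0 1) ∧ InjOn g (Icc 0 1) ∧
      g 0 = x ∧ g 1 = f x ∧ γ = g '' Icc 0 1 ∧
      ((⇑f '' γ) ∩ γ = {f x} ∨ ((⇑f '' γ) ∩ γ = {x, f x} ∧ f (f x) = x))

/-- An `N`-translation arc for `f` based at `x` (for `N = 1` this is just a translation arc). -/
def IsNTranslationArc (f : X ≃ₜ X) (N : ℕ) (γ : Set X) (x : X) : Prop :=
  IsTranslationArc f γ x ∧
    (2 ≤ N →
      (∀ k : ℕ, 2 ≤ k → k ≤ N - 1 → (⇑f)^[k] '' γ ∩ γ = ∅) ∧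
        ((⇑f)^[N] '' γ ∩ γ = ∅ ∨ ((⇑f)^[N] '' γ ∩ γ = {x} ∧ (⇑f)^[N + 1] x = x)))

/-- An ∞-translation arc: an `N`-translation arc for every `N ≥ 1`. -/
def IsInfTranslationArc (f : X ≃ₜ X) (γ : Set X) (x : X) : Prop :=
  ∀ N : ℕ, 1 ≤ N → IsNTranslationArc f N γ x

/-- A nonwandering homeomorphism. -/
def IsNonwanderingMap (f : X → X) : Prop :=
  ∀ V : Set X, IsOpen V → V.Nonempty → ∃ n : ℕ, 1 ≤ n ∧ (f^[n] '' V ∩ V).Nonempty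

/-- A loop contained in `A` which is not null-homotopic in `V`. -/
def IsEssentialLoopIn (V A : Set X) : Prop :=
  ∃ (z : ↥V) (δ : Path z z), (∀ t : unitInterval, (↑(δ t) : X) ∈ A) ∧
    ¬ δ.Homotopic (Path.refl z)

/-- An annular continuum: a continuum with an open annular neighborhood `V` such that `V ∖ K`
has exactly two components, each essential in `V`. -/
def IsAnnularContinuum (K : Set X) : Prop :=
  IsCompact K ∧ IsConnected K ∧ K.Nontrivial ∧
    ∃ V : Set X, IsOpen V ∧ K ⊆ V ∧
      Nonempty (↥V ≃ₜ AddCircle (1 : ℝ) × ↥(Ioo (0 : ℝ) 1)) ∧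
      ∃ D₁ D₂ : Set X, HasTwoComps (V \ K) D₁ D₂ ∧
        IsEssentialLoopIn V D₁ ∧ IsEssentialLoopIn V D₂

/-- A set contractible in the ambient surface: it has an open neighborhood homeomorphic to the
plane. -/
def ContractibleInSurface (K : Set X) : Prop :=
  ∃ W : Set X, IsOpen W ∧ K ⊆ W ∧ Nonempty (↥W ≃ₜ (ℝ × ℝ))

/-- `α ∈ ℝ/ℤ` is rational. -/
def IsRationalAC (α : AddCircle (1 : ℝ)) : Prop := ∃ r : ℚ, α = ((r : ℝ) : AddCircle (1 : ℝ))

/-- The constant `q(α,g)`: the smallest positive integer `q` with `‖qα‖ = 0` if `α` is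
rational, and `(2g+1)‖qα‖ < ‖α‖` if `α` is irrational. -/
def qConst (α : AddCircle (1 : ℝ)) (g : ℕ) : ℕ :=
  sInf {q : ℕ | 0 < q ∧
    ((IsRationalAC α ∧ ‖q • α‖ = 0) ∨
      (¬IsRationalAC α ∧ ((2 * g + 1 : ℕ) : ℝ) * ‖q • α‖ < ‖α‖))}

open Complex in
theorem eq_of_exp_eq_one {Y : Type*} [TopologicalSpace Y] {S : Set Y} (hS : IsPreconnected S)
    {k : Y → ℂ} (hk : ContinuousOn k S) (h1 : ∀ x ∈ S, exp (k x) = 1) {a b : Y}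
    (ha : a ∈ S) (hb : b ∈ S) : k a = k b := by
  wlog hab : (k a).im ≤ (k b).im generalizing a b
  · exact (this hb ha (le_of_not_ge hab)).symm
  obtain ⟨m, hm⟩ := exp_eq_one_iff.1 (h1 a ha)
  obtain ⟨n, hn⟩ := exp_eq_one_iff.1 (h1 b hb)
  have hpi := Real.pi_pos
  have him : ∀ j : ℤ, ((j : ℂ) * (2 * Real.pi * I)).im = j * (2 * Real.pi) := by
    intro j; simp
  by_contra hne
  have hmn : m < n := by
    have hle : (m : ℝ) ≤ n := by
      rw [hm, hn, him, him] at hab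
      exact le_of_mul_le_mul_right hab (by positivity)
    refine lt_of_le_of_ne (by exact_mod_cast hle) ?_
    rintro rfl
    exact hne (hm.trans hn.symm)
  have hmn' : (m : ℝ) + 1 ≤ n := by exact_mod_cast hmn
  have hord := (hS.image (fun x => (k x).im) (continuous_im.comp_continuousOn hk)).ordConnected
  obtain ⟨x, hx, hxv⟩ := hord.out (mem_image_of_mem _ ha) (mem_image_of_mem _ hb)
    (show (k a).im + Real.pi ∈ Icc (k a).im (k b).im by
      rw [hm, hn, him, him]; constructor <;> nlinarith)
  obtain ⟨j, hj⟩ := exp_eq_one_iff.1 (h1 x hx)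
  simp only [hj, hm, him] at hxv
  have h2 : (2 * j : ℝ) = 2 * m + 1 := by
    have : (2 * j - 2 * m - 1 : ℝ) * Real.pi = 0 := by linarith
    rcases mul_eq_zero.1 this with h | h
    · linarith
    · exact absurd h hpi.ne'
  have h3 : 2 * j = 2 * m + 1 := by exact_mod_cast h2
  omega

open Complex in
theorem exists_circleMap_notMem {V : Set ℂ} (hV : IsOpen V) (hsc : IsSimplyConnected V)
    (h0 : (0 : ℂ) ∉ V) {r : ℝ} (hr : 0 < r) : ∃ θ : ℝ, circleMap 0 r θ ∉ V := by
  by_contra! hall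
  obtain ⟨L, hLc, hL⟩ := exists_continuousOn_eqOn_exp_comp hsc hV (g := id) continuousOn_id
    (by simpa using h0)
  have hc : Continuous fun θ : ℝ => L (circleMap 0 r θ) - θ * I - Real.log r := by
    have : Continuous fun θ : ℝ => L (circleMap 0 r θ) :=
      hLc.comp_continuous (continuous_circleMap 0 r) hall
    exact (this.sub (continuous_ofReal.mul continuous_const)).sub continuous_const
  have := eq_of_exp_eq_one (isPreconnected_univ (α := ℝ)) hc.continuousOn (fun θ _ => by
    have h : exp (L (circleMap 0 r θ)) = circleMap 0 r θ := hL (hall θ)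
    rw [exp_sub, exp_sub, h, ← ofReal_exp, Real.exp_log hr]
    have : (r : ℂ) ≠ 0 := by exact_mod_cast hr.ne'
    simp only [circleMap, zero_add]
    field_simp [exp_ne_zero]) (mem_univ 0) (mem_univ (2 * Real.pi))
  have hper : circleMap 0 r (2 * Real.pi) = circleMap 0 r 0 := by
    simpa using periodic_circleMap 0 r 0
  rw [hper] at this
  have h2 : ((2 * Real.pi : ℝ) : ℂ) * I = 0 := by
    simp only [ofReal_zero, zero_mul, sub_zero] at this
    linear_combination this
  simp [Real.pi_ne_zero] at h2

open Complex in
/-- A subset of a circle about the origin that is relatively clopen in the trace of a simply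
connected set `V` separates the inside of the circle from its outside within `V`. -/
theorem not_preconnected_of_crossing {V : Set ℂ} (hV : IsOpen V) (hsc : IsSimplyConnected V)
    {r : ℝ} {K L : Set ℂ} (hK : IsClosed K) (hL : IsClosed L) (hLne : L.Nonempty)
    (hKL : V ∩ Metric.sphere 0 r ⊆ K ∪ L)
    (hd : ∀ z ∈ V, z ∈ K → z ∉ L) {s t : ℝ} (hs : 0 < s) (hsr : s < r) (hrt : r < t)
    (hseg : ∀ x ∈ Icc s t, (x : ℂ) ∈ V) (hrK : (r : ℂ) ∈ K) {S : Set ℂ} (hSV : S ⊆ V \ K)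
    (hS : IsPreconnected S) (hsS : (s : ℂ) ∈ S) (htS : (t : ℂ) ∈ S) : False := by
  have hKne : K.Nonempty := ⟨_, hrK⟩
  set v : ℂ → ℝ := fun z => Metric.infDist z L / (Metric.infDist z K + Metric.infDist z L)
    with hv
  have hvK : ∀ z ∈ V, z ∈ K → v z = 1 := by
    intro z hz hzK
    have h1 : Metric.infDist z K = 0 := Metric.infDist_zero_of_mem hzK
    have h2 := (hL.notMem_iff_infDist_pos hLne).1 (hd z hz hzK)
    simp [hv, h1, h2.ne']
  have hvL : ∀ z, z ∈ L → v z = 0 := by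
    intro z hzL
    simp [hv, Metric.infDist_zero_of_mem hzL]
  have hvc : ContinuousOn v V := by
    refine ContinuousOn.div (Metric.continuous_infDist_pt L).continuousOn
      ((Metric.continuous_infDist_pt K).add (Metric.continuous_infDist_pt L)).continuousOn ?_
    intro z hz h
    have h1 := Metric.infDist_nonneg (x := z) (s := K)
    have h2 := Metric.infDist_nonneg (x := z) (s := L)
    have hzK : z ∈ K := (hK.mem_iff_infDist_zero hKne).2 (by linarith)
    exact hd z hz hzK ((hL.mem_iff_infDist_zero hLne).2 (by linarith))
  have hvc' : ContinuousOn (fun z => (v z : ℂ) * (Real.pi * I)) V :=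
    (continuous_ofReal.comp_continuousOn hvc).mul continuousOn_const
  have key : ∀ W ⊆ V, ∀ f g : ℂ → ℂ, ContinuousOn f V → ContinuousOn g V →
      (∀ z ∈ W, ‖z‖ = r → f z = g z) →
      ContinuousOn (fun z => if ‖z‖ ≤ r then f z else g z) W := by
    intro W hW f g hf hg hfg
    rw [continuousOn_iff_continuous_domRestrict] at *
    refine Continuous.if_le (f := fun z : W => ‖(z : ℂ)‖) (g := fun _ => r)
      (f' := fun z : W => f z) (g' := fun z : W => g z) ?_ ?_ (by fun_prop) (by fun_prop) ?_
    · exact hf.comp (continuous_inclusion hW)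
    · exact hg.comp (continuous_inclusion hW)
    · exact fun z h => hfg z z.2 h
  set F : ℂ → ℂ := fun z =>
    if ‖z‖ ≤ r then exp (-((v z : ℂ) * (Real.pi * I))) else exp ((v z : ℂ) * (Real.pi * I)) with hF
  have hFc : ContinuousOn F V := by
    refine key V Subset.rfl _ _ (continuous_exp.comp_continuousOn hvc'.neg)
      (continuous_exp.comp_continuousOn hvc') ?_
    intro z hz hzr
    rcases hKL ⟨hz, by simpa using hzr⟩ with h | h
    · simp [hvK z hz h, exp_neg]
    · simp [hvL z h]
  obtain ⟨ℓ, hℓc, hℓ⟩ := exists_continuousOn_eqOn_exp_comp hsc hV hFc (by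
    rintro ⟨z, -, hz⟩
    simp only [hF] at hz
    split_ifs at hz <;> exact exp_ne_zero _ hz)
  have hℓ' : ∀ z ∈ V, exp (ℓ z) = F z := fun z hz => hℓ hz
  have hrV : (r : ℂ) ∈ V := hseg r ⟨hsr.le, hrt.le⟩
  have hr : 0 < r := hs.trans hsr
  have e1 : ℓ s + (v s : ℂ) * (Real.pi * I) = ℓ r + (v r : ℂ) * (Real.pi * I) := by
    refine eq_of_exp_eq_one (isPreconnected_Icc (a := s) (b := r))
      (k := fun x : ℝ => ℓ x + (v x : ℂ) * (Real.pi * I)) ?_ ?_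
      (left_mem_Icc.2 hsr.le) (right_mem_Icc.2 hsr.le)
    · exact (hℓc.add hvc').comp continuous_ofReal.continuousOn
        fun x hx => hseg x ⟨hx.1, hx.2.trans hrt.le⟩
    · intro x hx
      have hxn : ‖(x : ℂ)‖ ≤ r := by
        rw [norm_real, Real.norm_of_nonneg (hs.le.trans hx.1)]; exact hx.2
      rw [exp_add, hℓ' _ (hseg x ⟨hx.1, hx.2.trans hrt.le⟩)]
      simp only [hF, if_pos hxn, ← exp_add, neg_add_cancel, exp_zero]
  have e2 : ℓ r - (v r : ℂ) * (Real.pi * I) = ℓ t - (v t : ℂ) * (Real.pi * I) := by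
    refine eq_of_exp_eq_one (isPreconnected_Icc (a := r) (b := t))
      (k := fun x : ℝ => ℓ x - (v x : ℂ) * (Real.pi * I)) ?_ ?_
      (left_mem_Icc.2 hrt.le) (right_mem_Icc.2 hrt.le)
    · exact (hℓc.sub hvc').comp continuous_ofReal.continuousOn
        fun x hx => hseg x ⟨hsr.le.trans hx.1, hx.2⟩
    · intro x hx
      rw [exp_sub, hℓ' _ (hseg x ⟨hsr.le.trans hx.1, hx.2⟩), ← exp_zero, div_eq_iff (exp_ne_zero _)]
      rcases hx.1.eq_or_lt with rfl | hlt
      · simp [hF, hvK _ hrV hrK, exp_neg]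
      · have hxn : ¬ ‖(x : ℂ)‖ ≤ r := by
          rw [norm_real, Real.norm_of_nonneg (hr.le.trans hx.1)]; exact not_le.2 hlt
        simp only [hF, if_neg hxn, exp_zero, one_mul]
  have e3 := eq_of_exp_eq_one hS
    (k := fun z => ℓ z - if ‖z‖ ≤ r then -((v z : ℂ) * (Real.pi * I)) else
      (v z : ℂ) * (Real.pi * I)) ?_ ?_ hsS htS
  · have hsn : ‖(s : ℂ)‖ ≤ r := by
      rw [norm_real, Real.norm_of_nonneg hs.le]; exact hsr.le
    have htn : ¬ ‖(t : ℂ)‖ ≤ r := by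
      rw [norm_real, Real.norm_of_nonneg (hr.trans hrt).le]; exact not_le.2 hrt
    simp only [if_pos hsn, if_neg htn] at e3
    rw [hvK _ hrV hrK] at e1 e2
    have : (2 * Real.pi * I : ℂ) = 0 := by
      push_cast at e1 e2
      linear_combination e3 - e1 - e2
    simp [Real.pi_ne_zero] at this
  · refine (hℓc.mono fun z hz => (hSV hz).1).sub
      (key S (fun z hz => (hSV hz).1) _ _ hvc'.neg hvc' ?_)
    intro z hz hzr
    rcases hKL ⟨(hSV hz).1, by simpa using hzr⟩ with h | h
    · exact absurd h (hSV hz).2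
    · simp [hvL z h]
  · intro z hz
    rw [exp_sub, hℓ' z (hSV hz).1]
    simp only [hF]
    split_ifs
    · exact div_self (exp_ne_zero _)
    · exact div_self (exp_ne_zero _)

theorem exists_maximal_interval_of_periodic {P : Set ℝ} (hP : IsOpen P) {T : ℝ} (hT : 0 < T)
    (hper : ∀ x, x + T ∈ P ↔ x ∈ P) (h0 : (0 : ℝ) ∈ P) (hne : P ≠ univ) :
    ∃ a b : ℝ, a < 0 ∧ 0 < b ∧ b ≤ a + T ∧ a ∉ P ∧ b ∉ P ∧ Ioo a b ⊆ P := by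
  obtain ⟨p, hp⟩ := (ne_univ_iff_exists_notMem P).1 hne
  have hperz : ∀ n : ℤ, ∀ x, x + n * T ∈ P ↔ x ∈ P := by
    intro n
    induction n using Int.induction_on with
    | zero => simp
    | succ n ih => intro x; rw [← ih x, ← hper (x + ((n : ℤ) : ℝ) * T)]; push_cast; ring_nf
    | pred n ih =>
      intro x
      rw [← ih x, ← hper (x + ((-n - 1 : ℤ) : ℝ) * T)]
      push_cast
      ring_nf
  obtain ⟨q, hq, hqP⟩ : ∃ q ∈ Ico 0 T, q ∉ P := by
    refine ⟨toIcoMod hT 0 p, by simpa using toIcoMod_mem_Ico hT 0 p, ?_⟩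
    rw [toIcoMod, zsmul_eq_mul]
    rwa [← hperz (-toIcoDiv hT 0 p) p, Int.cast_neg, neg_mul, ← sub_eq_add_neg] at hp
  have hq' : q - T ∉ P := by rwa [← hper, sub_add_cancel]
  have hB : IsClosed (Pᶜ ∩ Ici 0) := hP.isClosed_compl.inter isClosed_Ici
  have hA : IsClosed (Pᶜ ∩ Iic 0) := hP.isClosed_compl.inter isClosed_Iic
  have hBb : BddBelow (Pᶜ ∩ Ici 0) := ⟨0, fun x hx => hx.2⟩
  have hAb : BddAbove (Pᶜ ∩ Iic 0) := ⟨0, fun x hx => hx.2⟩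
  have hb := hB.csInf_mem ⟨q, hqP, hq.1⟩ hBb
  have ha := hA.csSup_mem ⟨q - T, hq', show q - T ≤ 0 by linarith [hq.2]⟩ hAb
  set b := sInf (Pᶜ ∩ Ici 0)
  set a := sSup (Pᶜ ∩ Iic 0)
  have hb0 : b ≠ 0 := fun h => hb.1 (h ▸ h0)
  have ha0 : a ≠ 0 := fun h => ha.1 (h ▸ h0)
  refine ⟨a, b, lt_of_le_of_ne ha.2 ha0, lt_of_le_of_ne hb.2 hb0.symm, ?_, ha.1, hb.1, ?_⟩
  · have h1 : q - T ≤ a := le_csSup hAb ⟨hq', show q - T ≤ 0 by linarith [hq.2]⟩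
    refine csInf_le hBb ⟨?_, ?_⟩
    · exact fun h => ha.1 ((hper a).1 h)
    · show (0 : ℝ) ≤ a + T
      linarith [hq.1]
  · intro x hx
    by_contra hxP
    rcases le_total x 0 with h | h
    · exact absurd (le_csSup hAb ⟨hxP, h⟩) (not_le.2 hx.1)
    · exact absurd (csInf_le hBb ⟨hxP, h⟩) (not_le.2 hx.2)

open Complex in
theorem eventually_eq_circleMap {r θ : ℝ} (hr : 0 < r) {a b : ℝ} (ha : a < θ) (hb : θ < b)
    {ε : ℝ} (hε : 0 < ε) : ∀ᶠ z in 𝓝 (circleMap 0 r θ), ∃ s ∈ Ioo (r - ε) (r + ε),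
      ∃ φ ∈ Ioo a b, z = circleMap 0 s φ := by
  set y := circleMap 0 r θ with hy
  have hy0 : y ≠ 0 := by simp [hy, circleMap, hr.ne']
  have hn : ‖y‖ = r := by simp [hy, abs_of_pos hr]
  have h1 : ∀ᶠ z in 𝓝 y, ‖z‖ ∈ Ioo (r - ε) (r + ε) :=
    continuous_norm.continuousAt.eventually_mem (by
      rw [hn]; exact Ioo_mem_nhds (by linarith) (by linarith))
  have hc : ContinuousAt (fun z => θ + arg (z / y)) y := by
    refine continuousAt_const.add (ContinuousAt.comp (g := arg) ?_ ?_)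
    · rw [div_self hy0]; exact continuousAt_arg one_mem_slitPlane
    · exact continuousAt_id.div_const y
  have h2 : ∀ᶠ z in 𝓝 y, θ + arg (z / y) ∈ Ioo a b :=
    hc.eventually_mem (by
      rw [div_self hy0, arg_one, add_zero]; exact Ioo_mem_nhds ha hb)
  filter_upwards [h1, h2] with z hz1 hz2
  refine ⟨_, hz1, _, hz2, ?_⟩
  have h3 : (‖z / y‖ : ℂ) * exp (arg (z / y) * I) = z / y := norm_mul_exp_arg_mul_I _
  have h4 : z = y * (z / y) := by field_simp
  have h5 : (‖z‖ : ℂ) = r * ‖z / y‖ := by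
    rw [norm_div, hn]; push_cast
    have : (r : ℂ) ≠ 0 := by exact_mod_cast hr.ne'
    field_simp
  have hy2 : y = r * exp (θ * I) := by simp [hy, circleMap]
  clear_value y
  rw [circleMap, zero_add, h5, ofReal_add, add_mul, exp_add]
  linear_combination h4 - y * h3 + (‖z / y‖ : ℂ) * exp (arg (z / y) * I) * hy2

/-- The two components of the complement of a circular arc. -/
theorem mem_component_of_notMem_arc {V : Set ℂ} (hV : IsOpen V) (hVc : IsPreconnected V)
    (hseg : ∀ x ∈ Ioc (0 : ℝ) 1, (x : ℂ) ∈ V) {r : ℝ} (hr : r ∈ Ioo (0 : ℝ) 1) {α β : ℝ}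
    (hα : α < 0) (hβ : 0 < β) (hin : ∀ θ ∈ Ioo α β, circleMap 0 r θ ∈ V)
    (hcl : IsOpen (V \ circleMap 0 r '' Ioo α β)) :
    (∀ x ∈ Ioo 0 r, (x : ℂ) ∈
      connectedComponentIn (V \ circleMap 0 r '' Ioo α β) ((r / 2 : ℝ) : ℂ)) ∧
    (∀ x ∈ Ioc r 1, (x : ℂ) ∈
      connectedComponentIn (V \ circleMap 0 r '' Ioo α β) ((1 : ℝ) : ℂ)) ∧
    ∀ z ∈ V \ circleMap 0 r '' Ioo α β,
      z ∈ connectedComponentIn (V \ circleMap 0 r '' Ioo α β) ((r / 2 : ℝ) : ℂ) ∨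
      z ∈ connectedComponentIn (V \ circleMap 0 r '' Ioo α β) ((1 : ℝ) : ℂ) := by
  have hr0 := hr.1
  set c := circleMap 0 r '' Ioo α β with hc
  have hcs : ∀ z ∈ c, ‖z‖ = r := by
    rintro _ ⟨θ, -, rfl⟩; simp [abs_of_pos hr0]
  have hoff : ∀ z ∈ V, ‖z‖ ≠ r → z ∈ V \ c := fun z hz h => ⟨hz, fun hzc => h (hcs z hzc)⟩
  have hD : ∀ x ∈ Ioo 0 r, (x : ℂ) ∈ connectedComponentIn (V \ c) ((r / 2 : ℝ) : ℂ) := by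
    intro x hx
    have hp : IsPreconnected ((fun x : ℝ => (x : ℂ)) '' Ioo 0 r) :=
      isPreconnected_Ioo.image _ Complex.continuous_ofReal.continuousOn
    refine hp.subset_connectedComponentIn ⟨r / 2, ⟨by linarith, by linarith⟩, rfl⟩ ?_ ⟨x, hx, rfl⟩
    rintro _ ⟨y, hy, rfl⟩
    refine hoff _ (hseg y ⟨hy.1, hy.2.le.trans hr.2.le⟩) ?_
    rw [Complex.norm_real, Real.norm_of_nonneg hy.1.le]; exact hy.2.ne
  have hO : ∀ x ∈ Ioc r 1, (x : ℂ) ∈ connectedComponentIn (V \ c) ((1 : ℝ) : ℂ) := by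
    intro x hx
    have hp : IsPreconnected ((fun x : ℝ => (x : ℂ)) '' Ioc r 1) :=
      isPreconnected_Ioc.image _ Complex.continuous_ofReal.continuousOn
    refine hp.subset_connectedComponentIn ⟨1, ⟨hr.2, le_rfl⟩, rfl⟩ ?_ ⟨x, hx, rfl⟩
    rintro _ ⟨y, hy, rfl⟩
    refine hoff _ (hseg y ⟨hr0.trans hy.1, hy.2⟩) ?_
    rw [Complex.norm_real, Real.norm_of_nonneg (hr0.trans hy.1).le]; exact hy.1.ne'
  refine ⟨hD, hO, ?_⟩
  set D := connectedComponentIn (V \ c) ((r / 2 : ℝ) : ℂ) with hDdef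
  set O := connectedComponentIn (V \ c) ((1 : ℝ) : ℂ) with hOdef
  have hDo : IsOpen D := hcl.connectedComponentIn
  have hOo : IsOpen O := hcl.connectedComponentIn
  have hnear : ∀ θ ∈ Ioo α β, ∀ᶠ z in 𝓝 (circleMap 0 r θ), z ∈ D ∪ O ∪ c := by
    intro θ hθ
    obtain ⟨a, ha1, ha2⟩ := exists_between (lt_min hα hθ.1)
    obtain ⟨b, hb1, hb2⟩ := exists_between (max_lt hβ hθ.2)
    have ha0 := ha2.trans_le (min_le_left _ _)
    have haθ := ha2.trans_le (min_le_right _ _)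
    have hb0 := (le_max_left _ _).trans_lt hb1
    have hbθ := (le_max_right _ _).trans_lt hb1
    have hcont : Continuous fun p : ℝ × ℝ => circleMap 0 p.1 p.2 := by
      unfold circleMap; fun_prop
    obtain ⟨u, v, hu, hv, hru, hKv, huv⟩ := generalized_tube_lemma (s := {r}) (t := Icc a b)
      isCompact_singleton isCompact_Icc (hV.preimage hcont) (by
        rintro ⟨s, φ⟩ ⟨hs, hφ⟩
        obtain rfl : s = r := hs
        exact hin φ ⟨ha1.trans_le hφ.1, hφ.2.trans_lt hb2⟩)
    obtain ⟨ε, hε, hball⟩ := Metric.isOpen_iff.1 hu r (hru rfl)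
    rw [Real.ball_eq_Ioo] at hball
    set δ := min ε (min r (1 - r)) with hδ
    have hδ0 : 0 < δ := lt_min hε (lt_min hr0 (by linarith [hr.2]))
    have hδr : δ ≤ r := (min_le_right _ _).trans (min_le_left _ _)
    have hδr' : δ ≤ 1 - r := (min_le_right _ _).trans (min_le_right _ _)
    have hδε : δ ≤ ε := min_le_left _ _
    have hstrip : ∀ l ⊆ Ioo (r - δ) (r + δ), IsPreconnected l → r ∉ l → ∀ x ∈ l,
        (fun p : ℝ × ℝ => circleMap 0 p.1 p.2) '' (l ×ˢ Icc a b) ⊆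
          connectedComponentIn (V \ c) (x : ℂ) := by
      intro l hl hlc hrl x hx
      refine ((hlc.prod isPreconnected_Icc).image _ hcont.continuousOn).subset_connectedComponentIn
        ⟨(x, 0), ⟨hx, ha0.le, hb0.le⟩, by simp [circleMap]⟩ ?_
      rintro _ ⟨⟨s, φ⟩, ⟨hs, hφ⟩, rfl⟩
      have hs' := hl hs
      have hs0 : 0 < s := by linarith [hs'.1]
      refine hoff _ (huv ⟨hball ⟨by linarith [hs'.1], by linarith [hs'.2]⟩, hKv hφ⟩) ?_
      simp only [norm_circleMap_zero, abs_of_pos hs0]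
      rintro rfl
      exact hrl hs
    filter_upwards [eventually_eq_circleMap hr0 haθ hbθ hδ0]
    rintro _ ⟨s, hs, φ, hφ, rfl⟩
    rcases lt_trichotomy s r with h | rfl | h
    · refine Or.inl (Or.inl ?_)
      have h1 := hstrip (Ioo (r - δ) r) (fun x hx => ⟨hx.1, by linarith [hx.2]⟩)
        isPreconnected_Ioo (by simp) (r - δ / 2) ⟨by linarith, by linarith⟩
      have h2 := hD (r - δ / 2) ⟨by linarith, by linarith⟩
      rw [hDdef, connectedComponentIn_eq h2]
      exact h1 ⟨(s, φ), ⟨⟨hs.1, h⟩, Ioo_subset_Icc_self hφ⟩, rfl⟩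
    · exact Or.inr ⟨φ, ⟨ha1.trans hφ.1, hφ.2.trans hb2⟩, rfl⟩
    · refine Or.inl (Or.inr ?_)
      have h1 := hstrip (Ioo r (r + δ)) (fun x hx => ⟨by linarith [hx.1], hx.2⟩)
        isPreconnected_Ioo (by simp) (r + δ / 2) ⟨by linarith, by linarith⟩
      have h2 := hO (r + δ / 2) ⟨by linarith, by linarith⟩
      rw [hOdef, connectedComponentIn_eq h2]
      exact h1 ⟨(s, φ), ⟨⟨h, hs.2⟩, Ioo_subset_Icc_self hφ⟩, rfl⟩
  intro z hz
  by_contra hzn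
  have hcov : V ⊆ (D ∪ O ∪ interior (D ∪ O ∪ c)) ∪
      ⋃ y ∈ (V \ c) \ (D ∪ O), connectedComponentIn (V \ c) y := by
    intro y hy
    by_cases hyc : y ∈ c
    · obtain ⟨θ, hθ, rfl⟩ := hyc
      exact Or.inl (Or.inr (mem_interior_iff_mem_nhds.2 (hnear θ hθ)))
    · by_cases hyD : y ∈ D ∪ O
      · exact Or.inl (Or.inl hyD)
      · exact Or.inr (mem_biUnion (show y ∈ (V \ c) \ (D ∪ O) from ⟨⟨hy, hyc⟩, hyD⟩)
          (mem_connectedComponentIn ⟨hy, hyc⟩))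
  obtain ⟨x, -, hx1, hx2⟩ := hVc _ _ ((hDo.union hOo).union isOpen_interior)
    (isOpen_biUnion fun y _ => hcl.connectedComponentIn) hcov
    ⟨_, hseg 1 (by simp), Or.inl (Or.inr (hO 1 ⟨hr.2, le_rfl⟩))⟩
    ⟨z, hz.1, mem_biUnion (show z ∈ (V \ c) \ (D ∪ O) from ⟨hz, hzn⟩)
      (mem_connectedComponentIn hz)⟩
  obtain ⟨y, hy, hxy⟩ := mem_iUnion₂.1 hx2
  have hxc : x ∉ c := (connectedComponentIn_subset _ _ hxy).2
  have hxDO : x ∈ D ∪ O := by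
    rcases hx1 with h | h
    · exact h
    · exact (interior_subset h).resolve_right hxc
  have hyx := connectedComponentIn_eq hxy
  have hyy := mem_connectedComponentIn hy.1
  rcases hxDO with h | h
  · exact hy.2 (Or.inl (by rw [hDdef, connectedComponentIn_eq h, ← hyx]; exact hyy))
  · exact hy.2 (Or.inr (by rw [hOdef, connectedComponentIn_eq h, ← hyx]; exact hyy))

theorem IsCrossCut.isOpen_diff {X : Type*} [TopologicalSpace X] [T2Space X] {U γ : Set X}
    (hU : IsOpen U) (h : IsCrossCut U γ) : IsOpen (U \ γ) := by
  obtain ⟨g, hgc, -, -, h0, h1, rfl, -⟩ := h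
  have : U \ g '' Ioo 0 1 = U \ g '' Icc 0 1 := by
    refine Subset.antisymm ?_ (sdiff_subset_sdiff_right (image_mono Ioo_subset_Icc_self))
    rintro x ⟨hxU, hx⟩
    refine ⟨hxU, ?_⟩
    rintro ⟨t, ht, rfl⟩
    rw [hU.frontier_eq] at h0 h1
    rcases ht.1.eq_or_lt with rfl | ht0
    · exact h0.2 hxU
    rcases ht.2.eq_or_lt with rfl | ht1
    · exact h1.2 hxU
    exact hx ⟨t, ⟨ht0, ht1⟩, rfl⟩
  rw [this]
  exact hU.sdiff (isCompact_Icc.image_of_continuousOn hgc).isClosed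

theorem bdIn_subset {X : Type*} [TopologicalSpace X] [LocallyConnectedSpace X] {U γ D : Set X}
    (h : IsOpen (U \ γ)) (hD : IsCompOf (U \ γ) D) : bdIn U D ⊆ γ := by
  obtain ⟨x, hx, rfl⟩ := hD
  rintro y ⟨⟨hyc, hyD⟩, hyU⟩
  by_contra hyγ
  have hy : y ∈ U \ γ := ⟨hyU, hyγ⟩
  obtain ⟨z, hz1, hz2⟩ := mem_closure_iff.1 hyc _ h.connectedComponentIn
    (mem_connectedComponentIn hy)
  rw [connectedComponentIn_eq hz2, ← connectedComponentIn_eq hz1] at hyD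
  exact hyD (mem_connectedComponentIn hy)

/-- `g` parametrizes an arc of the circle of radius `r` about the origin that crosses the
segment `(0, 1]` and separates `V` into two components. -/
structure IsSeparatingArc (V : Set ℂ) (r : ℝ) (g : ℝ → ℂ) : Prop where
  continuousOn : ContinuousOn g (Icc 0 1)
  injOn : InjOn g (Ioo 0 1)
  mem : ∀ t ∈ Ioo (0 : ℝ) 1, g t ∈ V
  zero_notMem : g 0 ∉ V
  one_notMem : g 1 ∉ V
  norm_eq : ∀ t ∈ Icc (0 : ℝ) 1, ‖g t‖ = r
  radius_mem : (r : ℂ) ∈ g '' Ioo 0 1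
  inner : ∀ x ∈ Ioo 0 r, (x : ℂ) ∈ connectedComponentIn (V \ g '' Ioo 0 1) ((r / 2 : ℝ) : ℂ)
  outer : ∀ x ∈ Ioc r 1, (x : ℂ) ∈ connectedComponentIn (V \ g '' Ioo 0 1) ((1 : ℝ) : ℂ)
  cover : ∀ z ∈ V \ g '' Ioo 0 1,
    z ∈ connectedComponentIn (V \ g '' Ioo 0 1) ((r / 2 : ℝ) : ℂ) ∨
      z ∈ connectedComponentIn (V \ g '' Ioo 0 1) ((1 : ℝ) : ℂ)
  disjoint : Disjoint (connectedComponentIn (V \ g '' Ioo 0 1) ((r / 2 : ℝ) : ℂ))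
    (connectedComponentIn (V \ g '' Ioo 0 1) ((1 : ℝ) : ℂ))

theorem exists_isSeparatingArc {V : Set ℂ} (hV : IsOpen V) (hsc : IsSimplyConnected V)
    (h0 : (0 : ℂ) ∉ V) (hseg : ∀ x ∈ Ioc (0 : ℝ) 1, (x : ℂ) ∈ V) {r : ℝ}
    (hr : r ∈ Ioo (0 : ℝ) 1) : ∃ g, IsSeparatingArc V r g := by
  have hr0 := hr.1
  have hpi := Real.pi_pos
  obtain ⟨θ₀, hθ₀⟩ := exists_circleMap_notMem hV hsc h0 hr0
  have hE0 : circleMap 0 r 0 = r := by simp [circleMap]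
  have hper : ∀ x, circleMap 0 r (x + 2 * Real.pi) = circleMap 0 r x := periodic_circleMap 0 r
  obtain ⟨α, β, hα, hβ, hβα, hαV, hβV, hin⟩ := exists_maximal_interval_of_periodic
    (hV.preimage (continuous_circleMap 0 r)) (T := 2 * Real.pi) (by positivity)
    (fun x => by rw [mem_preimage, mem_preimage, hper])
    (by rw [mem_preimage, hE0]; exact hseg r ⟨hr0, hr.2.le⟩)
    (ne_univ_iff_exists_notMem _ |>.2 ⟨θ₀, hθ₀⟩)
  have hαβ : 0 < β - α := by linarith
  have hinj : InjOn (circleMap 0 r) (Ico α (α + 2 * Real.pi)) := by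
    refine injOn_circleMap_of_abs_sub_le' hr0.ne' ?_
    ring_nf
    rfl
  have himg : (fun t => α + (β - α) * t) '' Ioo 0 1 = Ioo α β := by
    have := image_affine_Ioo (K := ℝ) hαβ α 0 1
    simpa [add_comm] using this
  set g : ℝ → ℂ := fun t => circleMap 0 r (α + (β - α) * t) with hg
  have himg' : g '' Ioo 0 1 = circleMap 0 r '' Ioo α β := by
    rw [← himg, image_image]
  have hnorm : ∀ x, ‖circleMap 0 r x‖ = r := fun x => by simp [abs_of_pos hr0]
  have hmaps : ∀ t ∈ Ioo (0 : ℝ) 1, α + (β - α) * t ∈ Ioo α β := fun t ht =>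
    himg ▸ mem_image_of_mem _ ht
  set K := circleMap 0 r '' Icc α β with hK
  set L := circleMap 0 r '' Icc β (α + 2 * Real.pi) with hL
  have hKc : IsClosed K := (isCompact_Icc.image (continuous_circleMap 0 r)).isClosed
  have hLc : IsClosed L := (isCompact_Icc.image (continuous_circleMap 0 r)).isClosed
  have hVK : V \ circleMap 0 r '' Ioo α β = V \ K := by
    refine Subset.antisymm ?_ (sdiff_subset_sdiff_right (image_mono Ioo_subset_Icc_self))
    rintro z ⟨hzV, hz⟩
    refine ⟨hzV, ?_⟩
    rintro ⟨θ, hθ, rfl⟩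
    rcases hθ.1.eq_or_lt with rfl | h1
    · exact hαV hzV
    rcases hθ.2.eq_or_lt with rfl | h2
    · exact hβV hzV
    exact hz ⟨θ, ⟨h1, h2⟩, rfl⟩
  have hop : IsOpen (V \ circleMap 0 r '' Ioo α β) := by rw [hVK]; exact hV.sdiff hKc
  obtain ⟨hD, hO, hcov⟩ := mem_component_of_notMem_arc hV
    hsc.isPathConnected.isConnected.isPreconnected hseg hr hα hβ hin hop
  rw [← himg'] at hD hO hcov
  refine ⟨g, ⟨?_, ?_, ?_, ?_, ?_, ?_, ?_, hD, hO, hcov, ?_⟩⟩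
  · exact ((continuous_circleMap 0 r).comp (by fun_prop)).continuousOn
  · intro s hs t ht hst
    have hs' := hmaps s hs
    have ht' := hmaps t ht
    have := hinj ⟨hs'.1.le, hs'.2.trans_le hβα⟩ ⟨ht'.1.le, ht'.2.trans_le hβα⟩ hst
    exact mul_left_cancel₀ hαβ.ne' (add_left_cancel this)
  · exact fun t ht => hin (hmaps t ht)
  · simpa [hg] using hαV
  · simpa [hg] using hβV
  · exact fun t _ => hnorm _
  · rw [himg']; exact ⟨0, ⟨hα, hβ⟩, hE0⟩
  · by_contra hnd
    obtain ⟨z, hz1, hz2⟩ := not_disjoint_iff.1 hnd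
    have h1mem : ((1 : ℝ) : ℂ) ∈ V \ g '' Ioo 0 1 :=
      connectedComponentIn_subset _ _ (hO 1 ⟨hr.2, le_rfl⟩)
    have h2mem := hD (r / 2) ⟨by linarith, by linarith⟩
    rw [connectedComponentIn_eq hz1, ← connectedComponentIn_eq hz2] at h2mem
    refine not_preconnected_of_crossing hV hsc (r := r) (K := K) (L := L) hKc hLc
      ⟨_, mem_image_of_mem _ (left_mem_Icc.2 hβα)⟩ ?_ ?_ (s := r / 2) (t := 1)
      (by linarith) (by linarith) hr.2 (fun x hx => hseg x ⟨by linarith [hx.1], hx.2⟩)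
      ⟨0, ⟨hα.le, hβ.le⟩, hE0⟩ ?_ isPreconnected_connectedComponentIn h2mem
      (mem_connectedComponentIn h1mem)
    · rintro z ⟨-, hz⟩
      have hz' : z ∈ range (circleMap 0 r) := by
        rw [range_circleMap, abs_of_pos hr0]; exact hz
      obtain ⟨θ, rfl⟩ := hz'
      obtain ⟨φ, hφ, hθφ⟩ := (periodic_circleMap 0 r).exists_mem_Ico (by positivity) θ α
      rw [hθφ]
      rcases le_total φ β with h | h
      · exact Or.inl ⟨φ, ⟨hφ.1, h⟩, rfl⟩
      · exact Or.inr ⟨φ, ⟨h, hφ.2.le⟩, rfl⟩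
    · rintro _ hzV ⟨θ, hθ, rfl⟩ ⟨φ, hφ, hφθ⟩
      have hφ2 : φ ≠ α + 2 * Real.pi := by
        rintro rfl
        rw [hper] at hφθ
        exact hαV (by rw [mem_preimage, hφθ]; exact hzV)
      have hθ2 : θ ≠ β := by
        rintro rfl
        exact hβV hzV
      have hθβ := lt_of_le_of_ne hθ.2 hθ2
      have := hinj ⟨by linarith [hφ.1], lt_of_le_of_ne hφ.2 hφ2⟩
        ⟨hθ.1, hθβ.trans_le hβα⟩ hφθ
      linarith [hφ.1]
    · rw [← hVK, ← himg']
      exact connectedComponentIn_subset _ _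

/-- Near a boundary point at the tip of a segment there is a nested sequence of cross-sections
cut off by disjoint arcs shrinking to that point. -/
theorem exists_crossSection_seq_complex {V : Set ℂ} (hV : IsOpen V) (hsc : IsSimplyConnected V)
    (h0 : (0 : ℂ) ∉ V) (hseg : ∀ x ∈ Ioc (0 : ℝ) 1, (x : ℂ) ∈ V) :
    ∃ D : ℕ → Set ℂ, (∀ i, IsCrossSection V (D i)) ∧ Antitone D ∧
      (∀ i j, i ≠ j → closure (bdIn V (D i)) ∩ closure (bdIn V (D j)) = ∅) ∧
      (∀ S ⊆ V, IsPreconnected S → (0 : ℂ) ∉ closure S → ∃ i, Disjoint S (D i)) ∧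
      ∀ i, ∃ ρ > (0 : ℝ), ∀ x ∈ Ioo 0 ρ, (x : ℂ) ∈ D i := by
  have hex : ∀ r : ℝ, ∃ g, r ∈ Ioo (0 : ℝ) 1 → IsSeparatingArc V r g := fun r => by
    by_cases hr : r ∈ Ioo (0 : ℝ) 1
    · obtain ⟨g, hg⟩ := exists_isSeparatingArc hV hsc h0 hseg hr
      exact ⟨g, fun _ => hg⟩
    · exact ⟨0, fun h => absurd h hr⟩
  choose g hg using hex
  have h1V : ((1 : ℝ) : ℂ) ∈ V := hseg 1 (by simp)
  set c : ℝ → Set ℂ := fun r => g r '' Ioo 0 1 with hc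
  set D : ℝ → Set ℂ := fun r => connectedComponentIn (V \ c r) ((r / 2 : ℝ) : ℂ) with hD
  set O : ℝ → Set ℂ := fun r => connectedComponentIn (V \ c r) ((1 : ℝ) : ℂ) with hO
  have hcn : ∀ r ∈ Ioo (0 : ℝ) 1, ∀ z ∈ c r, ‖z‖ = r := by
    rintro r hr _ ⟨t, ht, rfl⟩
    exact (hg r hr).norm_eq t (Ioo_subset_Icc_self ht)
  have hcV : ∀ r ∈ Ioo (0 : ℝ) 1, c r ⊆ V := by
    rintro r hr _ ⟨t, ht, rfl⟩
    exact (hg r hr).mem t ht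
  have hclos : ∀ r ∈ Ioo (0 : ℝ) 1, ∀ t ∈ Icc (0 : ℝ) 1, g r t ∈ closure (c r) := by
    intro r hr t ht
    refine (((hg r hr).continuousOn t ht).mono Ioo_subset_Icc_self).mem_closure_image ?_
    rwa [closure_Ioo zero_ne_one]
  have hcO : ∀ r ∈ Ioo (0 : ℝ) 1, ∀ r' ∈ Ioo (0 : ℝ) 1, r < r' → c r' ⊆ O r := by
    intro r hr r' hr' hlt
    have hpre : IsPreconnected (c r') :=
      isPreconnected_Ioo.image _ ((hg r' hr').continuousOn.mono Ioo_subset_Icc_self)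
    have h1 := hpre.subset_connectedComponentIn (hg r' hr').radius_mem
      (F := V \ c r) (fun z hz => ⟨hcV r' hr' hz, fun hz' => by
        rw [← hcn r hr z hz', ← hcn r' hr' z hz] at hlt; exact lt_irrefl _ hlt⟩)
    rwa [← connectedComponentIn_eq ((hg r hr).outer r' ⟨hlt, hr'.2.le⟩)] at h1
  have hne : ∀ r ∈ Ioo (0 : ℝ) 1, ((r / 2 : ℝ) : ℂ) ∈ D r := fun r hr =>
    (hg r hr).inner _ ⟨by linarith [hr.1], by linarith [hr.1]⟩
  have hneO : ∀ r ∈ Ioo (0 : ℝ) 1, ((1 : ℝ) : ℂ) ∈ O r := fun r hr =>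
    (hg r hr).outer _ ⟨hr.2, le_rfl⟩
  have hDV : ∀ r, D r ⊆ V \ c r := fun r => connectedComponentIn_subset _ _
  have hOV : ∀ r, O r ⊆ V \ c r := fun r => connectedComponentIn_subset _ _
  have htip : ∀ r ∈ Ioo (0 : ℝ) 1, (0 : ℂ) ∈ closure (D r) := by
    intro r hr
    have h : (0 : ℝ) ∈ closure (Ioo 0 r) := by
      rw [closure_Ioo hr.1.ne]; exact left_mem_Icc.2 hr.1.le
    have := Complex.continuous_ofReal.continuousAt.continuousWithinAt.mem_closure_image
      (s := Ioo 0 r) h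
    rw [Complex.ofReal_zero] at this
    refine closure_mono ?_ this
    rintro _ ⟨x, hx, rfl⟩
    exact (hg r hr).inner x hx
  have hcut : ∀ r ∈ Ioo (0 : ℝ) 1, IsCrossCut V (c r) := by
    intro r hr
    have hfr : ∀ z ∉ V, z ∈ closure V → z ∈ frontier V := fun z hz hz' => by
      rw [hV.frontier_eq]; exact ⟨hz', hz⟩
    have hclV := fun t ht => closure_mono (hcV r hr) (hclos r hr t ht)
    refine ⟨g r, (hg r hr).continuousOn, (hg r hr).injOn, (hg r hr).mem,
      hfr _ (hg r hr).zero_notMem (hclV 0 (by simp)),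
      hfr _ (hg r hr).one_notMem (hclV 1 (by simp)), rfl, D r, O r,
      ⟨⟨_, hDV r (hne r hr), rfl⟩, ⟨_, hOV r (hneO r hr), rfl⟩, ?_, ?_⟩, ?_, ?_⟩
    · intro h
      exact disjoint_left.1 (hg r hr).disjoint (hne r hr) (show _ ∈ O r from h ▸ hne r hr)
    · intro z hz
      exact ((hg r hr).cover z hz).imp (fun h => (connectedComponentIn_eq h).symm)
        (fun h => (connectedComponentIn_eq h).symm)
    · have hcD := htip r hr
      refine ⟨0, ⟨hcD, fun h => h0 (hDV r (interior_subset h)).1⟩,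
        hfr 0 h0 (closure_mono (fun z hz => (hDV r hz).1) hcD), ?_⟩
      rintro ⟨t, ht, h⟩
      have := (hg r hr).norm_eq t ht
      rw [h, norm_zero] at this
      exact hr.1.ne this
    · obtain ⟨r', hrr', hr'1⟩ := exists_between hr.2
      have hr' : r' ∈ Ioo (0 : ℝ) 1 := ⟨hr.1.trans hrr', hr'1⟩
      have hzV := (hg r' hr').zero_notMem
      have hcl := hclos r' hr' 0 (by simp)
      have hclO := closure_mono (hcO r hr r' hr' hrr') hcl
      refine ⟨g r' 0, ⟨hclO, fun h => hzV (hOV r (interior_subset h)).1⟩,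
        hfr _ hzV (closure_mono (hcV r' hr') hcl), ?_⟩
      rintro ⟨t, ht, h⟩
      have h1 := (hg r hr).norm_eq t ht
      rw [h, (hg r' hr').norm_eq 0 (by simp)] at h1
      exact hrr'.ne' h1
  have hmono : ∀ r ∈ Ioo (0 : ℝ) 1, ∀ r' ∈ Ioo (0 : ℝ) 1, r ≤ r' → D r ⊆ D r' := by
    intro r hr r' hr' hle
    rcases hle.eq_or_lt with rfl | hlt
    · exact Subset.rfl
    have h1 := (isPreconnected_connectedComponentIn (F := V \ c r)
      (x := ((r / 2 : ℝ) : ℂ))).subset_connectedComponentIn (hne r hr) (F := V \ c r')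
      (fun z hz => ⟨(hDV r hz).1, fun hz' =>
        disjoint_left.1 (hg r hr).disjoint hz (hcO r hr r' hr' hlt hz')⟩)
    have h2 := (hg r' hr').inner (r / 2) ⟨by linarith [hr.1], by linarith [hr.1]⟩
    rwa [← connectedComponentIn_eq h2] at h1
  have hbd : ∀ r ∈ Ioo (0 : ℝ) 1, closure (bdIn V (D r)) ⊆ Metric.sphere 0 r := by
    intro r hr
    refine closure_minimal (fun z hz => ?_) Metric.isClosed_sphere
    have := bdIn_subset ((hcut r hr).isOpen_diff hV) ⟨_, hDV r (hne r hr), rfl⟩ hz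
    simpa using hcn r hr z this
  set R : ℕ → ℝ := fun i => 1 / ((i : ℝ) + 2) with hR
  have hRm : ∀ i, R i ∈ Ioo (0 : ℝ) 1 := fun i => by
    refine ⟨by positivity, ?_⟩
    rw [hR]
    simp only
    rw [div_lt_one (by positivity)]
    have : (0 : ℝ) ≤ i := i.cast_nonneg
    linarith
  have hRanti : ∀ i j, i ≤ j → R j ≤ R i := fun i j hij => by
    have : (i : ℝ) ≤ j := by exact_mod_cast hij
    exact one_div_le_one_div_of_le (by positivity) (by linarith)
  have hRinj : ∀ i j, R i = R j → i = j := fun i j h => by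
    have h' : (i : ℝ) + 2 = j + 2 := by simpa [hR] using h
    exact_mod_cast add_right_cancel h'
  refine ⟨fun i => D (R i), fun i => ⟨_, hcut _ (hRm i), _, hDV _ (hne _ (hRm i)), rfl⟩,
    fun i j hij => hmono _ (hRm j) _ (hRm i) (hRanti i j hij), ?_, ?_, ?_⟩
  · intro i j hij
    rw [eq_empty_iff_forall_notMem]
    rintro z ⟨hz1, hz2⟩
    have h1 := hbd _ (hRm i) hz1
    have h2 := hbd _ (hRm j) hz2
    rw [mem_sphere_zero_iff_norm] at h1 h2
    exact hij (hRinj i j (h1.symm.trans h2))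
  · intro S hSV hS h0S
    rcases S.eq_empty_or_nonempty with rfl | ⟨z, hz⟩
    · exact ⟨0, empty_disjoint _⟩
    obtain ⟨p, hp⟩ := hsc.isPathConnected.joinedIn z (hSV hz) _ h1V
    have hpc : IsCompact (range p) := isCompact_range p.continuous
    have hpV : range p ⊆ V := range_subset_iff.2 hp
    have hQ : IsPreconnected (S ∪ range p) :=
      hS.union z hz ⟨0, p.source⟩ (isPreconnected_range p.continuous)
    have h0Q : (0 : ℂ) ∉ closure (S ∪ range p) := by
      rw [closure_union, hpc.isClosed.closure_eq]
      rintro (h | h)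
      · exact h0S h
      · exact h0 (hpV h)
    obtain ⟨ε, hε, hball⟩ := Metric.isOpen_iff.1 isClosed_closure.isOpen_compl 0 h0Q
    obtain ⟨n, hn⟩ := exists_nat_one_div_lt hε
    have hRn : R n < ε := by
      refine lt_of_le_of_lt (one_div_le_one_div_of_le (by positivity) (by linarith)) hn
    refine ⟨n, ?_⟩
    have hsub : S ∪ range p ⊆ O (R n) := by
      refine hQ.subset_connectedComponentIn (Or.inr ⟨1, p.target⟩) fun x hx => ⟨?_, fun hxc => ?_⟩
      · exact union_subset hSV hpV hx
      · refine hball ?_ (subset_closure hx)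
        rw [mem_ball_zero_iff, hcn _ (hRm n) x hxc]
        exact hRn
    exact ((hg _ (hRm n)).disjoint.mono_right (subset_union_left.trans hsub)).symm
  · exact fun i => ⟨R i, (hRm i).1, fun x hx => (hg _ (hRm i)).inner x hx⟩

theorem IsCompOf.image {Y : Type*} [TopologicalSpace Y] (T : X ≃ₜ Y) {A D : Set X}
    (h : IsCompOf A D) : IsCompOf (T '' A) (T '' D) := by
  obtain ⟨x, hx, rfl⟩ := h
  exact ⟨T x, mem_image_of_mem T hx, T.image_connectedComponentIn hx⟩

theorem IsCrossCut.image {Y : Type*} [TopologicalSpace Y] (T : X ≃ₜ Y) {U γ : Set X}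
    (h : IsCrossCut U γ) : IsCrossCut (T '' U) (T '' γ) := by
  obtain ⟨g, hgc, hgi, hgU, h0, h1, rfl, D₁, D₂, ⟨hD₁, hD₂, hne, hall⟩, hf₁, hf₂⟩ := h
  have hfr : ∀ D : Set X, (frontier D ∩ (frontier U \ g '' Icc 0 1)).Nonempty →
      (frontier (T '' D) ∩ (frontier (T '' U) \ (T ∘ g) '' Icc 0 1)).Nonempty := by
    intro D hD
    rw [image_comp, ← T.image_frontier, ← T.image_frontier, ← image_sdiff T.injective,
      ← image_inter T.injective]
    exact hD.image T
  have hsd : T '' U \ T '' (g '' Ioo 0 1) = T '' (U \ g '' Ioo 0 1) :=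
    (image_sdiff T.injective _ _).symm
  refine ⟨T ∘ g, T.continuous.comp_continuousOn hgc, T.injective.comp_injOn hgi,
    fun t ht => mem_image_of_mem T (hgU t ht), ?_, ?_, (image_comp _ _ _).symm, T '' D₁, T '' D₂,
    ⟨?_, ?_, ?_, ?_⟩, hfr _ hf₁, hfr _ hf₂⟩
  · rw [← T.image_frontier]; exact mem_image_of_mem T h0
  · rw [← T.image_frontier]; exact mem_image_of_mem T h1
  · rw [hsd]; exact hD₁.image T
  · rw [hsd]; exact hD₂.image T
  · exact fun h => hne (T.injective.image_injective h)
  · rw [hsd]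
    rintro _ ⟨x, hx, rfl⟩
    rw [← T.image_connectedComponentIn hx]
    exact (hall x hx).imp (fun h => by rw [h]) (fun h => by rw [h])

theorem IsCrossSection.image {Y : Type*} [TopologicalSpace Y] (T : X ≃ₜ Y) {U D : Set X}
    (h : IsCrossSection U D) : IsCrossSection (T '' U) (T '' D) := by
  obtain ⟨γ, hγ, hD⟩ := h
  refine ⟨T '' γ, hγ.image T, ?_⟩
  rw [← image_sdiff T.injective]
  exact hD.image T

theorem image_bdIn {Y : Type*} [TopologicalSpace Y] (T : X ≃ₜ Y) (U D : Set X) :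
    bdIn (T '' U) (T '' D) = T '' bdIn U D := by
  rw [bdIn, bdIn, ← T.image_closure, ← image_sdiff T.injective, ← image_inter T.injective]

/-- A sequence of cross-sections shrinking to the boundary point `w`: nested, cut off by arcs
with disjoint closures, and eventually avoiding each connected set staying away from `w`. -/
structure IsShrinkingChain (U : Set X) (w : X) (D : ℕ → Set X) : Prop where
  isCrossSection : ∀ i, IsCrossSection U (D i)
  antitone : Antitone D
  closure_bdIn : ∀ i j, i ≠ j → closure (bdIn U (D i)) ∩ closure (bdIn U (D j)) = ∅
  exists_disjoint : ∀ S ⊆ U, IsPreconnected S → w ∉ closure S → ∃ i, Disjoint S (D i)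

theorem exists_isShrinkingChain {U : Set (ℝ × ℝ)} (hU : IsOpen U) (hsc : IsSimplyConnected U)
    {w x : ℝ × ℝ} (hw : w ∉ U) (hseg : ∀ t ∈ Ioc (0 : ℝ) 1, w + t • (x - w) ∈ U) :
    ∃ D : ℕ → Set (ℝ × ℝ), IsShrinkingChain U w D ∧
      ∀ i, ∃ ρ > (0 : ℝ), ∀ t ∈ Ioo 0 ρ, w + t • (x - w) ∈ D i := by
  have hxU : x ∈ U := by simpa using hseg 1 (by simp)
  have hxw : x - w ≠ 0 := fun h => hw (sub_eq_zero.1 h ▸ hxU)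
  set e := Complex.equivRealProdCLM
  have he : e.symm (x - w) ≠ 0 := fun h => hxw ((e.symm.map_eq_zero_iff).1 h)
  set T : ℂ ≃ₜ ℝ × ℝ := ((Homeomorph.mulRight₀ _ he).trans e.toHomeomorph).trans
    (Homeomorph.addLeft w) with hT
  have hT0 : T 0 = w := by simp [hT]
  have hTt : ∀ t : ℝ, T t = w + t • (x - w) := by
    intro t
    have h1 : T t = w + e ((t : ℂ) * e.symm (x - w)) := rfl
    have h2 : (t : ℂ) * e.symm (x - w) = t • e.symm (x - w) := by
      rw [Complex.real_smul]
    rw [h1, h2, map_smul, e.apply_symm_apply]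
  have himg : T '' (T ⁻¹' U) = U := T.image_preimage U
  obtain ⟨D, hcs, hanti, hdisj, hev, htip⟩ := exists_crossSection_seq_complex
    (hU.preimage T.continuous) (T.isSimplyConnected_preimage.2 hsc)
    (by rw [mem_preimage, hT0]; exact hw) (fun t ht => by rw [mem_preimage, hTt]; exact hseg t ht)
  refine ⟨fun i => T '' D i, ⟨fun i => ?_, fun i j hij => image_mono (hanti hij), ?_, ?_⟩, ?_⟩
  · have := (hcs i).image T
    rwa [himg] at this
  · intro i j hij
    rw [← himg, image_bdIn, image_bdIn, ← T.image_closure, ← T.image_closure,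
      ← image_inter T.injective, hdisj i j hij, image_empty]
  · intro S hS hSc hwS
    obtain ⟨i, hi⟩ := hev (T ⁻¹' S) (preimage_mono hS) (T.isPreconnected_preimage.2 hSc) (by
      rw [← T.preimage_closure, mem_preimage, hT0]; exact hwS)
    refine ⟨i, ?_⟩
    rw [← T.image_preimage S]
    exact (disjoint_image_iff T.injective).2 hi
  · intro i
    obtain ⟨ρ, hρ, h⟩ := htip i
    exact ⟨ρ, hρ, fun t ht => ⟨t, h t ht, hTt t⟩⟩

theorem IsCrossSection.isPreconnected {U D : Set X} (h : IsCrossSection U D) :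
    IsPreconnected D := by
  obtain ⟨γ, -, x, -, rfl⟩ := h
  exact isPreconnected_connectedComponentIn

theorem IsCrossSection.nonempty {U D : Set X} (h : IsCrossSection U D) : D.Nonempty := by
  obtain ⟨γ, -, x, hx, rfl⟩ := h
  exact ⟨x, mem_connectedComponentIn hx⟩

theorem IsCrossSection.subset {U D : Set X} (h : IsCrossSection U D) : D ⊆ U := by
  obtain ⟨γ, -, x, -, rfl⟩ := h
  exact (connectedComponentIn_subset _ _).trans sdiff_subset

theorem IsCrossSection.isOpen [T2Space X] [LocallyConnectedSpace X] {U D : Set X} (hU : IsOpen U)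
    (h : IsCrossSection U D) : IsOpen D := by
  obtain ⟨γ, hγ, x, -, rfl⟩ := h
  exact (hγ.isOpen_diff hU).connectedComponentIn

theorem IsShrinkingChain.exists_disjoint_of_arc [T2Space X] {U : Set X} {w : X} {D : ℕ → Set X}
    (hD : IsShrinkingChain U w D) {g : ℝ → X} (hg : ContinuousOn g (Icc 0 1))
    (hgU : ∀ t ∈ Ioo (0 : ℝ) 1, g t ∈ U) {B : Set X} (hB : B ⊆ g '' Ioo 0 1)
    (hw : w ∉ closure B) : ∃ i, Disjoint B (D i) := by
  have key : ∃ i, Disjoint (B ∩ g '' (Icc 0 1 ∩ Ioo 0 1)) (D i) := by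
    refine isCompact_Icc.induction_on (p := fun s => ∃ i, Disjoint (B ∩ g '' (s ∩ Ioo 0 1)) (D i))
      ⟨0, by simp⟩ ?_ ?_ ?_
    · rintro s t hst ⟨i, hi⟩
      exact ⟨i, hi.mono_left (by gcongr)⟩
    · rintro s t ⟨i, hi⟩ ⟨j, hj⟩
      refine ⟨max i j, ?_⟩
      rw [union_inter_distrib_right, image_union, inter_union_distrib_left, disjoint_union_left]
      exact ⟨hi.mono_right (hD.antitone (le_max_left _ _)),
        hj.mono_right (hD.antitone (le_max_right _ _))⟩
    · intro t ht
      by_cases hgt : g t = w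
      · refine ⟨g ⁻¹' (closure B)ᶜ, hg t ht (isClosed_closure.isOpen_compl.mem_nhds
          (by rw [hgt]; exact hw)), 0, ?_⟩
        have : B ∩ g '' (g ⁻¹' (closure B)ᶜ ∩ Ioo 0 1) = ∅ := by
          rw [eq_empty_iff_forall_notMem]
          rintro _ ⟨hb, s, hs, rfl⟩
          exact hs.1 (subset_closure hb)
        rw [this]
        exact empty_disjoint _
      · obtain ⟨A, A', hA, hA', hgA, hwA', hAA'⟩ := t2_separation hgt
        obtain ⟨ε, hε, hsub⟩ := Metric.mem_nhdsWithin_iff.1 (hg t ht (hA.mem_nhds hgA))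
        rw [Real.ball_eq_Ioo] at hsub
        have hS : g '' (Ioo (t - ε) (t + ε) ∩ Ioo 0 1) ⊆ A := by
          rintro _ ⟨s, hs, rfl⟩
          exact hsub ⟨hs.1, Ioo_subset_Icc_self hs.2⟩
        have hwS : w ∉ closure (g '' (Ioo (t - ε) (t + ε) ∩ Ioo 0 1)) := by
          intro h
          obtain ⟨y, hy1, hy2⟩ := mem_closure_iff.1 h A' hA' hwA'
          exact disjoint_left.1 hAA' (hS hy2) hy1
        obtain ⟨i, hi⟩ := hD.exists_disjoint (g '' (Ioo (t - ε) (t + ε) ∩ Ioo 0 1))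
          (by rintro _ ⟨s, hs, rfl⟩; exact hgU s hs.2)
          ((ordConnected_Ioo.inter ordConnected_Ioo).isPreconnected.image _
            (hg.mono (inter_subset_right.trans Ioo_subset_Icc_self)))
          hwS
        refine ⟨Ioo (t - ε) (t + ε), mem_nhdsWithin_of_mem_nhds
          (Ioo_mem_nhds (by linarith) (by linarith)), i, hi.mono_left inter_subset_right⟩
  obtain ⟨i, hi⟩ := key
  rw [inter_eq_right.2 Ioo_subset_Icc_self, inter_eq_left.2 hB] at hi
  exact ⟨i, hi⟩

theorem IsShrinkingChain.isPrimeChain [T2Space X] [LocallyConnectedSpace X] {U : Set X}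
    (hU : IsOpen U) {w : X} {D : ℕ → Set X} (hD : IsShrinkingChain U w D) : IsPrimeChain U D := by
  refine ⟨⟨hD.isCrossSection, fun i j hij => hD.antitone hij, hD.closure_bdIn⟩, ?_⟩
  intro D' hD' hdiv n
  obtain ⟨k, hk, hwk⟩ : ∃ k, n ≤ k ∧ w ∉ closure (bdIn U (D' k)) := by
    by_contra! h
    exact (eq_empty_iff_forall_notMem.1 (hD'.2.2 n (n + 1) (by omega)) w)
      ⟨h n le_rfl, h (n + 1) (by omega)⟩
  obtain ⟨γ, hγ, hcomp⟩ := hD'.1 k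
  have hbd := bdIn_subset (hγ.isOpen_diff hU) hcomp
  obtain ⟨g, hgc, -, hgU, -, -, rfl, -⟩ := hγ
  obtain ⟨i, hi⟩ := hD.exists_disjoint_of_arc hgc hgU hbd hwk
  obtain ⟨m, hm⟩ := hdiv i
  refine ⟨i, Subset.trans ?_ (hD'.2.1 k n hk)⟩
  obtain ⟨y, hy⟩ := (hD'.1 (max m k)).nonempty
  refine (hD.isCrossSection i).isPreconnected.subset_of_closure_inter_subset
    ((hD'.1 k).isOpen hU)
    ⟨y, hm (hD'.2.1 _ m (le_max_left _ _) hy), hD'.2.1 _ k (le_max_right _ _) hy⟩ ?_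
  rintro z ⟨hz1, hz2⟩
  by_contra hz
  exact disjoint_left.1 hi ⟨⟨hz1, hz⟩, (hD.isCrossSection i).subset hz2⟩ hz2

theorem ChainDivides.trans {Y : Type*} {D₁ D₂ D₃ : ℕ → Set Y} (h₁ : ChainDivides D₁ D₂)
    (h₂ : ChainDivides D₂ D₃) : ChainDivides D₁ D₃ := fun n => by
  obtain ⟨m, hm⟩ := h₂ n
  obtain ⟨k, hk⟩ := h₁ m
  exact ⟨k, hk.trans hm⟩

theorem chainDivides_of_mk_eq {U : Set X} {C C' : PrimeChain U}
    (h : (Quot.mk _ C : PrimeEnd U) = Quot.mk _ C') : ChainDivides C.1 C'.1 := by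
  have := Quot.eqvGen_exact h
  suffices ChainDivides C.1 C'.1 ∧ ChainDivides C'.1 C.1 from this.1
  clear h
  induction this with
  | rel _ _ h => exact h
  | refl x => exact ⟨fun n => ⟨n, Subset.rfl⟩, fun n => ⟨n, Subset.rfl⟩⟩
  | symm _ _ _ ih => exact ih.symm
  | trans _ _ _ _ _ ih₁ ih₂ => exact ⟨ih₁.1.trans ih₂.1, ih₂.2.trans ih₁.2⟩

theorem primeEndDivides_mk_iff {U E : Set X} {C : PrimeChain U} :
    PrimeEndDivides (Quot.mk _ C : PrimeEnd U) E ↔ ∃ n, C.1 n ⊆ E := by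
  constructor
  · rintro ⟨C', hC', N, hN⟩
    obtain ⟨m, hm⟩ := chainDivides_of_mk_eq hC'.symm N
    exact ⟨m, hm.trans (hN N le_rfl)⟩
  · rintro ⟨n, hn⟩
    exact ⟨C, rfl, n, fun i hi => (C.2.1.2.1 i n hi).trans hn⟩

theorem peEnd_mem_peSection_iff {U E : Set X} {p : PrimeEnd U} :
    peEnd U p ∈ peSection U E ↔ PrimeEndDivides p E := by
  constructor
  · rintro (⟨x, hx, -⟩ | ⟨q, hq, h⟩)
    · cases hx
    · cases hq
      exact h
  · exact fun h => Or.inr ⟨p, rfl, h⟩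

theorem peEnd_notMem_peOpen {U V : Set X} {p : PrimeEnd U} : peEnd U p ∉ peOpen U V := by
  rintro ⟨x, hx, -⟩
  cases hx

theorem isAccessiblePrimeEnd_mk {U : Set X} {C : PrimeChain U} {γ : ℝ → X} (hγ : IsEndCut U γ)
    (h : ∀ i, ∀ᶠ t in 𝓝[<] (1 : ℝ), γ t ∈ C.1 i) : IsAccessiblePrimeEnd U (Quot.mk _ C) := by
  refine ⟨γ, hγ.2.2.1, hγ, ?_⟩
  refine TopologicalSpace.tendsto_nhds_generateFrom_iff.2 ?_
  rintro s (⟨V, -, -, rfl⟩ | ⟨E, -, rfl⟩) hs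
  · exact absurd hs peEnd_notMem_peOpen
  · obtain ⟨n, hn⟩ := primeEndDivides_mk_iff.1 (peEnd_mem_peSection_iff.1 hs)
    filter_upwards [preimage_mem_comap (h n)] with t ht
    exact Or.inl ⟨_, rfl, hn ht⟩

/-- Prime ends dividing a deep enough member of a chain of `p` lie in a given neighborhood
of `p`. -/
theorem exists_forall_mem_of_isOpen {U : Set X} {C : PrimeChain U} {W : Set (PrimeEndComp U)}
    (hW : IsOpen W) (hC : peEnd U (Quot.mk _ C) ∈ W) :
    ∃ n, ∀ q : PrimeEnd U, PrimeEndDivides q (C.1 n) → peEnd U q ∈ W := by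
  obtain ⟨_, ⟨f, ⟨hff, hfs⟩, rfl⟩, hpf, hfW⟩ :=
    (TopologicalSpace.isTopologicalBasis_of_subbasis rfl).exists_subset_of_mem_open hC hW
  have hall : ∀ᶠ n in atTop, ∀ s ∈ f, ∀ q : PrimeEnd U, PrimeEndDivides q (C.1 n) →
      peEnd U q ∈ s := by
    refine (eventually_all_finite hff).2 fun s hs => ?_
    have hps := hpf s hs
    rcases hfs hs with ⟨V, -, -, rfl⟩ | ⟨E, -, rfl⟩
    · exact absurd hps peEnd_notMem_peOpen
    · obtain ⟨m, hm⟩ := primeEndDivides_mk_iff.1 (peEnd_mem_peSection_iff.1 hps)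
      filter_upwards [eventually_ge_atTop m] with n hn q hq
      obtain ⟨C', rfl, N, hN⟩ := hq
      exact peEnd_mem_peSection_iff.2
        (primeEndDivides_mk_iff.2 ⟨N, (hN N le_rfl).trans ((C.2.1.2.1 n m hn).trans hm)⟩)
  obtain ⟨n, hn⟩ := hall.exists
  exact ⟨n, fun q hq => hfW fun s hs => hn s hs q hq⟩

theorem exists_radial_segment {U : Set (ℝ × ℝ)} (hU : IsOpen U) {x z : ℝ × ℝ} (hx : x ∈ U)
    (hz : z ∉ U) : ∃ w ∉ U, dist x w ≤ dist x z ∧ ∀ t ∈ Ioc (0 : ℝ) 1,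
      w + t • (x - w) ∈ U ∧ dist (w + t • (x - w)) x < dist x w := by
  obtain ⟨w, hw, hdw⟩ := hU.isClosed_compl.exists_infDist_eq_dist ⟨z, hz⟩ x
  have hpos : 0 < dist x w := dist_pos.2 fun h => hw (h ▸ hx)
  have hdist : ∀ t ∈ Ioc (0 : ℝ) 1, dist (w + t • (x - w)) x < dist x w := by
    intro t ht
    have : w + t • (x - w) - x = -((1 - t) • (x - w)) := by module
    rw [dist_eq_norm, this, norm_neg, norm_smul, Real.norm_of_nonneg (by linarith [ht.2]),
      ← dist_eq_norm]
    nlinarith [ht.1]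
  refine ⟨w, hw, hdw ▸ Metric.infDist_le_dist_of_mem hz, fun t ht => ⟨?_, hdist t ht⟩⟩
  by_contra h
  have h1 := Metric.infDist_le_dist_of_mem (x := x) (show w + t • (x - w) ∈ Uᶜ from h)
  rw [hdw, dist_comm x (w + _)] at h1
  exact absurd (hdist t ht) (not_lt.2 h1)

theorem isEndCut_radial {U : Set (ℝ × ℝ)} {w x : ℝ × ℝ} (hw : w ∉ U)
    (hseg : ∀ t ∈ Ioc (0 : ℝ) 1, w + t • (x - w) ∈ U) :
    IsEndCut U (fun t => w + (1 - t) • (x - w)) ∧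
      Tendsto (fun t : ℝ => w + (1 - t) • (x - w)) (𝓝[<] 1) (𝓝 w) := by
  have hxU : x ∈ U := by simpa using hseg 1 (by simp)
  have hxw : x - w ≠ 0 := fun h => hw (sub_eq_zero.1 h ▸ hxU)
  have hc : Continuous fun t : ℝ => w + (1 - t) • (x - w) := by fun_prop
  have ht : Tendsto (fun t : ℝ => w + (1 - t) • (x - w)) (𝓝[<] 1) (𝓝 w) := by
    have := (hc.tendsto 1).mono_left (nhdsWithin_le_nhds (s := Iio 1))
    simpa using this
  refine ⟨⟨hc.continuousOn, ?_, fun t ht => hseg _ ⟨by linarith [ht.2], by linarith [ht.1]⟩, w, ht⟩,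
    ht⟩
  intro s _ t _ hst
  have := smul_left_injective ℝ hxw (add_left_cancel hst)
  linarith

theorem exists_accessible_primeEndDivides {U : Set (ℝ × ℝ)} (hU : IsOpen U)
    (hsc : IsSimplyConnected U) {E : Set (ℝ × ℝ)} (hE : IsCrossSection U E) :
    ∃ p : PrimeEnd U, IsAccessiblePrimeEnd U p ∧ PrimeEndDivides p E := by
  have hEo := hE.isOpen hU
  have hEU := hE.subset
  obtain ⟨γ, hγ, hcomp⟩ := hE
  obtain ⟨g, hgc, -, hgU, -, -, rfl, D₁, D₂, ⟨-, -, -, hall⟩, hf₁, hf₂⟩ := hγ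
  have hfr : (frontier E ∩ (frontier U \ g '' Icc 0 1)).Nonempty := by
    obtain ⟨y, hy, rfl⟩ := hcomp
    rcases hall y hy with h | h <;> rw [h] <;> assumption
  obtain ⟨z, hzE, hzU, hzg⟩ := hfr
  have hgcl : IsClosed (g '' Icc 0 1) := (isCompact_Icc.image_of_continuousOn hgc).isClosed
  obtain ⟨δ, hδ, hball⟩ := Metric.isOpen_iff.1 hgcl.isOpen_compl z hzg
  obtain ⟨x, hxE, hxz⟩ := Metric.mem_closure_iff.1 (frontier_subset_closure hzE) (δ / 2)
    (by positivity)
  rw [dist_comm] at hxz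
  rw [hU.frontier_eq] at hzU
  obtain ⟨w, hw, hxw, hseg⟩ := exists_radial_segment hU (hEU hxE) hzU.2
  have hgw : w ∉ g '' Icc 0 1 := hball (by
    rw [Metric.mem_ball]
    linarith [dist_triangle w x z, dist_comm w x])
  have hsegE : ∀ t ∈ Ioc (0 : ℝ) 1, w + t • (x - w) ∈ E := by
    intro t ht
    obtain ⟨y, hy, rfl⟩ := hcomp
    have hpre : IsPreconnected ((fun t : ℝ => w + t • (x - w)) '' Ioc 0 1) :=
      isPreconnected_Ioc.image _ (by fun_prop)
    rw [connectedComponentIn_eq hxE]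
    refine hpre.subset_connectedComponentIn ⟨1, by simp, by simp⟩ ?_ ⟨t, ht, rfl⟩
    rintro _ ⟨s, hs, rfl⟩
    refine ⟨(hseg s hs).1, fun h => hball ?_ (image_mono Ioo_subset_Icc_self h)⟩
    rw [Metric.mem_ball]
    linarith [dist_triangle (w + s • (x - w)) x z, (hseg s hs).2]
  have hsegU := fun t ht => (hseg t ht).1
  obtain ⟨D, hD, htip⟩ := exists_isShrinkingChain hU hsc hw hsegU
  have hcut := isEndCut_radial hw hsegU
  refine ⟨Quot.mk _ ⟨D, hD.isPrimeChain hU⟩, isAccessiblePrimeEnd_mk hcut.1 fun i => ?_,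
    primeEndDivides_mk_iff.2 ?_⟩
  · obtain ⟨ρ, hρ, h⟩ := htip i
    filter_upwards [Ioo_mem_nhdsLT (show 1 - ρ < 1 by linarith)] with t ht
    exact h _ ⟨by linarith [ht.2], by linarith [ht.1]⟩
  · obtain ⟨i, hi⟩ := hD.exists_disjoint_of_arc hgc hgU Subset.rfl fun h =>
      hgw (closure_minimal (image_mono Ioo_subset_Icc_self) hgcl h)
    refine ⟨i, ?_⟩
    obtain ⟨ρ, hρ, h⟩ := htip i
    have hm : 0 < min ρ 1 := lt_min hρ one_pos
    have h1 := h (min ρ 1 / 2) ⟨by linarith, by linarith [min_le_left ρ 1]⟩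
    have h2 := hsegE (min ρ 1 / 2) ⟨by linarith, by linarith [min_le_right ρ 1]⟩
    obtain ⟨y, hy, rfl⟩ := hcomp
    rw [connectedComponentIn_eq h2]
    exact (hD.isCrossSection i).isPreconnected.subset_connectedComponentIn h1 fun v hv =>
      ⟨(hD.isCrossSection i).subset hv, fun hvD => disjoint_left.1 hi hvD hv⟩

/-- Accessible prime ends are dense in the circle of prime ends, and
accessible points of `∂U` are dense in `∂U`. -/
theorem accessible_prime_ends_and_points_dense
    (U : Set (ℝ × ℝ)) (hUopen : IsOpen U) (hUsc : SimplyConnectedSpace ↥U)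
    (hUcompl : Set.Nontrivial Uᶜ) :
    Dense {w : ↥(PrimeEndCircle U) |
        ∃ p : PrimeEnd U, (w : PrimeEndComp U) = peEnd U p ∧ IsAccessiblePrimeEnd U p} ∧
      frontier U ⊆ closure {z : ℝ × ℝ | z ∈ frontier U ∧ IsAccessiblePoint U z} := by
  constructor
  · rintro ⟨_, p, rfl⟩
    rw [mem_closure_iff]
    rintro _ ⟨W, hW, rfl⟩ hpW
    obtain ⟨C, rfl⟩ := Quot.exists_rep p
    obtain ⟨n, hn⟩ := exists_forall_mem_of_isOpen hW hpW
    obtain ⟨q, hq, hqn⟩ := exists_accessible_primeEndDivides hUopen hUsc (C.2.1.1 n)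
    exact ⟨⟨peEnd U q, q, rfl⟩, hn q hqn, q, rfl, hq⟩
  · intro z hz
    rw [Metric.mem_closure_iff]
    intro ε hε
    obtain ⟨x, hxU, hxz⟩ := Metric.mem_closure_iff.1 (frontier_subset_closure hz) (ε / 2)
      (by positivity)
    rw [hUopen.frontier_eq] at hz
    obtain ⟨w, hw, hxw, hseg⟩ := exists_radial_segment hUopen hxU hz.2
    obtain ⟨hcut, hlim⟩ := isEndCut_radial hw fun t ht => (hseg t ht).1
    refine ⟨w, ⟨?_, _, hcut, hlim⟩, ?_⟩
    · rw [hUopen.frontier_eq]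
      refine ⟨mem_closure_of_tendsto hlim ?_, hw⟩
      filter_upwards [Ioo_mem_nhdsLT (show (0 : ℝ) < 1 by norm_num)] with t ht
      exact hcut.2.2.1 t (Ioo_subset_Ico_self ht)
    · linarith [dist_triangle z x w, dist_comm x z]

end
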